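/- Let S be a finite set and n ≥ 1, and let μ be an exchangeable probability distribution on Sⁿ, i.e., a probability measure on Sⁿ invariant under all permutations of the coordinates. Then there exist finitely many real numbers a₁,…,a_N and probability measures ν₁,…,ν_N on S such that μ = Σ_{k=1}^N a_k ν_k^⊗n (an identity of measures on Sⁿ, where ν^⊗n is the n-fold product measure) and Σ_{k=1}^N |a_k| ≤ κ(n). Moreover the constant κ(n) is best possible: for S = {1,…,n} and μ the distribution of a uniformly random permutation of (1,…,n), every such representation satisfies Σ_k |a_k| ≥ κ(n). -/

import Mathlib

open scoped BigOperators TensorProduct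
open PiTensorProduct

noncomputable section

/-- The projective tensor norm `‖·‖_π` on the `n`-th algebraic tensor power `E^⊗n`. -/
def projNorm {E : Type*} [NormedAddCommGroup E] [NormedSpace ℝ E] (n : ℕ)
    (t : ⨂[ℝ] (_ : Fin n), E) : ℝ :=
  sInf {s : ℝ | ∃ (N : ℕ) (a : Fin N → ℝ) (x : Fin N → Fin n → E),
    t = ∑ k, a k • (⨂ₜ[ℝ] i, x k i) ∧ s = ∑ k, |a k| * ∏ i, ‖x k i‖}

/-- The positive projective tensor norm `‖·‖_{π+}` on `E^⊗n`: only decompositions into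
elementary tensors of elements of the positive cone `P` are allowed. -/
def projNormPos {E : Type*} [NormedAddCommGroup E] [NormedSpace ℝ E] (P : Set E) (n : ℕ)
    (t : ⨂[ℝ] (_ : Fin n), E) : ℝ :=
  sInf {s : ℝ | ∃ (N : ℕ) (a : Fin N → ℝ) (x : Fin N → Fin n → E),
    (∀ k i, x k i ∈ P) ∧ t = ∑ k, a k • (⨂ₜ[ℝ] i, x k i) ∧
    s = ∑ k, |a k| * ∏ i, ‖x k i‖}

/-- The symmetric projective tensor norm `‖·‖_{πs}` (decompositions into tensor powers). -/
def symProjNorm {E : Type*} [NormedAddCommGroup E] [NormedSpace ℝ E] (n : ℕ)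
    (t : ⨂[ℝ] (_ : Fin n), E) : ℝ :=
  sInf {s : ℝ | ∃ (N : ℕ) (a : Fin N → ℝ) (x : Fin N → E),
    t = ∑ k, a k • (⨂ₜ[ℝ] (_ : Fin n), x k) ∧ s = ∑ k, |a k| * ‖x k‖ ^ n}

/-- The positive symmetric projective tensor norm `‖·‖_{πs+}` (decompositions into tensor
powers of elements of the positive cone `P`). -/
def symProjNormPos {E : Type*} [NormedAddCommGroup E] [NormedSpace ℝ E] (P : Set E) (n : ℕ)
    (t : ⨂[ℝ] (_ : Fin n), E) : ℝ :=
  sInf {s : ℝ | ∃ (N : ℕ) (a : Fin N → ℝ) (x : Fin N → E),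
    (∀ k, x k ∈ P) ∧ t = ∑ k, a k • (⨂ₜ[ℝ] (_ : Fin n), x k) ∧
    s = ∑ k, |a k| * ‖x k‖ ^ n}

/-- `‖x‖₊ = inf{‖y‖+‖z‖ : x = y − z, y,z ∈ P}`. -/
def normPlus {E : Type*} [NormedAddCommGroup E] (P : Set E) (x : E) : ℝ :=
  sInf {r : ℝ | ∃ y ∈ P, ∃ z ∈ P, x = y - z ∧ r = ‖y‖ + ‖z‖}

/-- `c₊(E) = sup{‖x‖₊ : ‖x‖ ≤ 1}`. -/
def cPlus {E : Type*} [NormedAddCommGroup E] (P : Set E) : ℝ :=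
  sSup {r : ℝ | ∃ x : E, ‖x‖ ≤ 1 ∧ r = normPlus P x}

/-- `P` is a closed generating cone in `E`, i.e. `E` with `P` is an ordered normed space
with `E = P − P`. -/
def IsGenCone {E : Type*} [NormedAddCommGroup E] [NormedSpace ℝ E] (P : Set E) : Prop :=
  IsClosed P ∧ (∀ x ∈ P, ∀ y ∈ P, x + y ∈ P) ∧
    (∀ (c : ℝ), 0 ≤ c → ∀ x ∈ P, c • x ∈ P) ∧
    ∀ x : E, ∃ y ∈ P, ∃ z ∈ P, x = y - z

/-- `c₊(E)` is finite. -/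
def CPlusFinite {E : Type*} [NormedAddCommGroup E] (P : Set E) : Prop :=
  BddAbove {r : ℝ | ∃ x : E, ‖x‖ ≤ 1 ∧ r = normPlus P x}

/-- The `j`-th standard basis vector of `ℓ₁^m`. -/
def l1e (m : ℕ) (j : Fin m) : PiLp 1 fun _ : Fin m => ℝ :=
  (WithLp.equiv 1 (Fin m → ℝ)).symm (Pi.single j 1)

/-- The positive cone of coordinatewise nonnegative vectors in `ℓ₁^m`. -/
def l1cone (m : ℕ) : Set (PiLp 1 fun _ : Fin m => ℝ) := {x | ∀ i, 0 ≤ x i}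

/-- `κ(n) := ‖e₁ ∨ ⋯ ∨ eₙ‖_{πs+}` computed in `ℓ₁ⁿ`, where
`x₁ ∨ ⋯ ∨ xₙ = (1/n!)·Σ_{σ ∈ Sₙ} x_{σ(1)} ⊗ ⋯ ⊗ x_{σ(n)}`. -/
def kappa (n : ℕ) : ℝ :=
  symProjNormPos (l1cone n) n
    ((n.factorial : ℝ)⁻¹ • ∑ σ : Equiv.Perm (Fin n), ⨂ₜ[ℝ] i, l1e n (σ i))

theorem aux_compact_hull {E : Type*} [NormedAddCommGroup E] [NormedSpace ℝ E]
    [FiniteDimensional ℝ E] {s : Set E} (hs : IsCompact s) : IsCompact (convexHull ℝ s) := by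
  rcases s.eq_empty_or_nonempty with rfl | ⟨p, hp⟩
  · simp
  set d := Module.finrank ℝ E + 1 with hd
  have hK : IsCompact ((stdSimplex ℝ (Fin d)) ×ˢ (Set.pi Set.univ (fun _ : Fin d => s))) :=
    (isCompact_stdSimplex ℝ (Fin d)).prod (isCompact_univ_pi fun _ => hs)
  have hc : Continuous (fun q : (Fin d → ℝ) × (Fin d → E) => ∑ i, q.1 i • q.2 i) := by fun_prop
  convert hK.image hc using 1
  ext x
  constructor
  · intro hx
    obtain ⟨ι, hι, z, w, hz, hai, hw0, hw1, hx⟩ := eq_pos_convex_span_of_mem_convexHull hx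
    have hcard : Fintype.card ι ≤ Fintype.card (Fin d) := by
      rw [Fintype.card_fin]
      have := hai.card_le_finrank_succ
      have h2 := Submodule.finrank_le (vectorSpan ℝ (Set.range z))
      omega
    obtain ⟨e⟩ := Function.Embedding.nonempty_of_card_le hcard
    have he : ∀ i, Function.extend e w 0 (e i) = w i := fun i => e.injective.extend_apply _ _ _
    have he' : ∀ i, Function.extend e z (fun _ => p) (e i) = z i :=
      fun i => e.injective.extend_apply _ _ _
    have hn : ∀ j, j ∉ Set.range e → Function.extend e w 0 j = 0 := by
      intro j hj
      rw [Function.extend_apply' _ _ _ (by simpa using hj)]; rfl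
    refine ⟨(Function.extend e w 0, Function.extend e z (fun _ => p)), ⟨⟨?_, ?_⟩, ?_⟩, ?_⟩
    · intro j
      by_cases hj : j ∈ Set.range e
      · obtain ⟨i, rfl⟩ := hj
        simp only [he]; exact (hw0 i).le
      · exact (hn j hj).ge
    · rw [← hw1]
      exact (Fintype.sum_of_injective e e.injective _ _ hn (fun i => (he i).symm)).symm
    · intro j _
      by_cases hj : j ∈ Set.range e
      · obtain ⟨i, rfl⟩ := hj
        simp only [he']; exact hz ⟨i, rfl⟩
      · simp only; rw [Function.extend_apply' _ _ _ (by simpa using hj)]; exact hp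
    · rw [← hx]
      refine (Fintype.sum_of_injective e e.injective _ _ ?_ ?_).symm
      · intro j hj; simp only [hn j hj, zero_smul]
      · intro i; simp only [he, he']
  · rintro ⟨⟨w, z⟩, ⟨⟨h0, h1⟩, h2⟩, rfl⟩
    exact mem_convexHull_of_exists_fintype w z h0 h1 (fun i => h2 i trivial) rfl

/-- coordinates of the symmetrised tensor -/
def auxU (n : ℕ) (x : Fin n → Fin n) : ℝ :=
  Set.indicator {y : Fin n → Fin n | Function.Bijective y} (fun _ => ((n.factorial : ℝ))⁻¹) x

theorem aux_sum_U (n : ℕ) {M : Type*} [AddCommGroup M] [Module ℝ M]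
    (g : (Fin n → Fin n) → M) :
    ∑ f, auxU n f • g f = (n.factorial : ℝ)⁻¹ • ∑ σ : Equiv.Perm (Fin n), g σ := by
  rw [Finset.smul_sum]
  symm
  refine Fintype.sum_of_injective (fun σ : Equiv.Perm (Fin n) => (σ : Fin n → Fin n))
    DFunLike.coe_injective _ _ ?_ ?_
  · intro f hf
    have : ¬ Function.Bijective f := fun h => hf ⟨Equiv.ofBijective f h, rfl⟩
    rw [auxU, Set.indicator_of_notMem (by exact this), zero_smul]
  · intro σ
    rw [auxU, Set.indicator_of_mem (by exact σ.bijective)]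

theorem aux_expand (n : ℕ) (x : Fin n → PiLp 1 fun _ : Fin n => ℝ) :
    (⨂ₜ[ℝ] i, x i) = ∑ f : Fin n → Fin n, (∏ i, x i (f i)) • ⨂ₜ[ℝ] i, l1e n (f i) := by
  have h : ∀ y : PiLp 1 fun _ : Fin n => ℝ, y = ∑ j, y j • l1e n j := by
    intro y
    ext j
    simp [l1e, Pi.single_apply]
  have : x = fun i => ∑ j, x i j • l1e n j := funext fun i => h (x i)
  conv_lhs => rw [this]
  rw [MultilinearMap.map_sum]
  refine Finset.sum_congr rfl fun f _ => ?_
  rw [MultilinearMap.map_smul_univ]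

theorem aux_coord (n N : ℕ) (a : Fin N → ℝ) (x : Fin N → PiLp 1 fun _ : Fin n => ℝ) :
    (((n.factorial : ℝ)⁻¹ • ∑ σ : Equiv.Perm (Fin n), ⨂ₜ[ℝ] i, l1e n (σ i)) =
      ∑ k, a k • (⨂ₜ[ℝ] (_ : Fin n), x k)) ↔
    ∀ f : Fin n → Fin n, auxU n f = ∑ k, a k * ∏ i, x k (f i) := by
  rw [← aux_sum_U n (fun f => ⨂ₜ[ℝ] i, l1e n (f i))]
  constructor
  · intro h f
    let m : MultilinearMap ℝ (fun _ : Fin n => PiLp 1 fun _ : Fin n => ℝ) ℝ :=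
      (MultilinearMap.mkPiAlgebra ℝ (Fin n) ℝ).compLinearMap
        (fun i => (PiLp.projₗ 1 (fun _ : Fin n => ℝ) (f i) : _ →ₗ[ℝ] ℝ))
    have hm : ∀ y, m y = ∏ i, y i (f i) := by intro y; simp [m]
    have := congrArg (PiTensorProduct.lift m) h
    simp only [map_sum, map_smul, PiTensorProduct.lift.tprod, hm, smul_eq_mul] at this
    rw [← this]
    rw [Finset.sum_eq_single f]
    · simp [l1e]
    · intro g _ hg
      obtain ⟨i, hi⟩ := Function.ne_iff.mp hg
      rw [Finset.prod_eq_zero (Finset.mem_univ i), mul_zero]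
      simp [l1e, Pi.single_apply, Ne.symm hi]
    · simp
  · intro h
    simp_rw [aux_expand n (fun _ => x _), Finset.smul_sum, h, Finset.sum_smul]
    rw [Finset.sum_comm]
    simp_rw [smul_smul]

/-- the set of admissible costs -/
def auxT (n : ℕ) : Set ℝ :=
  {s : ℝ | ∃ (N : ℕ) (a : Fin N → ℝ) (x : Fin N → PiLp 1 fun _ : Fin n => ℝ),
    (∀ k, x k ∈ l1cone n) ∧
    (∀ f : Fin n → Fin n, auxU n f = ∑ k, a k * ∏ i, x k (f i)) ∧
    s = ∑ k, |a k| * ‖x k‖ ^ n}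

theorem aux_kappa (n : ℕ) : kappa n = sInf (auxT n) := by
  unfold kappa symProjNormPos auxT
  simp only [aux_coord]

theorem aux_bdd (n : ℕ) : BddBelow (auxT n) := by
  refine ⟨0, ?_⟩
  rintro s ⟨N, a, x, -, -, rfl⟩
  positivity

theorem aux_norm {n : ℕ} {x : PiLp 1 fun _ : Fin n => ℝ} (hx : x ∈ l1cone n) :
    ‖x‖ = ∑ i, x i := by
  rw [PiLp.norm_eq_of_L1]
  exact Finset.sum_congr rfl fun i _ => by rw [Real.norm_of_nonneg (hx i)]

theorem aux_prod_sum (n : ℕ) {S : Type*} [Fintype S] (y : S → ℝ) :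
    ∑ f : Fin n → S, ∏ i, y (f i) = (∑ s, y s) ^ n := by
  classical
  have := (Finset.prod_univ_sum (fun _ : Fin n => (Finset.univ : Finset S)) (fun _ s => y s)).symm
  simpa using this

theorem aux_one_le (n : ℕ) {s : ℝ} (hs : s ∈ auxT n) : 1 ≤ s := by
  obtain ⟨N, a, x, hx, h, rfl⟩ := hs
  have h1 : ∑ f, auxU n f = 1 := by
    have := aux_sum_U n (fun _ => (1 : ℝ))
    simp only [smul_eq_mul, mul_one, Finset.sum_const, Finset.card_univ, Fintype.card_perm,
      Fintype.card_fin, nsmul_eq_mul] at this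
    rw [this]
    exact inv_mul_cancel₀ (by exact_mod_cast n.factorial_ne_zero)
  have h2 : ∑ f, auxU n f = ∑ k, a k * ‖x k‖ ^ n := by
    simp_rw [h]
    rw [Finset.sum_comm]
    refine Finset.sum_congr rfl fun k _ => ?_
    rw [← Finset.mul_sum, aux_prod_sum n (fun s => x k s), aux_norm (hx k)]
  rw [← h1, h2]
  refine Finset.sum_le_sum fun k _ => ?_
  gcongr
  exact le_abs_self _

theorem aux_nonempty (n : ℕ) : (auxT n).Nonempty := by
  classical
  let e := (Fintype.equivFin (Finset (Fin n))).symm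
  refine ⟨_, Fintype.card (Finset (Fin n)),
    fun k => (n.factorial : ℝ)⁻¹ * (-1) ^ (e k).card,
    fun k => WithLp.toLp 1 (fun j => if j ∈ e k then 0 else 1), ?_, ?_, rfl⟩
  · intro k j
    simp only
    split_ifs <;> norm_num
  · intro f
    rw [e.sum_comp (fun B : Finset (Fin n) => (n.factorial : ℝ)⁻¹ * (-1) ^ B.card *
      ∏ i, (if f i ∈ B then (0:ℝ) else 1))]
    have h1 : ∀ B : Finset (Fin n), (∏ i, (if f i ∈ B then (0:ℝ) else 1)) =
        if B ∈ ((Finset.univ.image f)ᶜ).powerset then 1 else 0 := by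
      intro B
      by_cases hB : ∃ i, f i ∈ B
      · obtain ⟨i, hi⟩ := hB
        rw [Finset.prod_eq_zero (Finset.mem_univ i) (by simp [hi]), if_neg]
        intro h
        have := Finset.mem_powerset.mp h hi
        simp at this
      · push Not at hB
        rw [if_pos, Finset.prod_eq_one]
        · intro i _; simp [hB i]
        · rw [Finset.mem_powerset]
          intro j hj
          simp only [Finset.mem_compl, Finset.mem_image, Finset.mem_univ, true_and]
          rintro ⟨i, rfl⟩
          exact hB i hj
    simp_rw [h1, mul_ite, mul_one, mul_zero]
    rw [Finset.sum_ite_mem, Finset.univ_inter, ← Finset.mul_sum]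
    have h2 := congrArg (Int.cast : ℤ → ℝ)
      (Finset.sum_powerset_neg_one_pow_card (x := (Finset.univ.image f)ᶜ))
    push_cast at h2
    rw [h2]
    have h3 : (Finset.univ.image f)ᶜ = ∅ ↔ Function.Bijective f := by
      rw [Finset.compl_eq_empty_iff, ← Finite.surjective_iff_bijective]
      simp [Finset.eq_univ_iff_forall, Function.Surjective]
    simp only [auxU, Set.indicator_apply, Set.mem_setOf_eq, h3, mul_ite, mul_one, mul_zero]

theorem aux_attain (n : ℕ) (hn : 1 ≤ n) :
    ∃ (ι : Type) (_ : Fintype ι) (a : ι → ℝ) (ν : ι → Fin n → ℝ),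
      (∀ k, ν k ∈ stdSimplex ℝ (Fin n)) ∧
      (∀ f : Fin n → Fin n, auxU n f = ∑ k, a k * ∏ i, ν k (f i)) ∧
      ∑ k, |a k| ≤ kappa n := by
  have hκ : 1 ≤ kappa n := by
    rw [aux_kappa]
    exact le_csInf (aux_nonempty n) fun s hs => aux_one_le n hs
  let φ : (Fin n → ℝ) → ((Fin n → Fin n) → ℝ) := fun ν f => ∏ i, ν (f i)
  have hφ : Continuous φ := by fun_prop
  let K := φ '' stdSimplex ℝ (Fin n) ∪ (fun ν => - φ ν) '' stdSimplex ℝ (Fin n)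
  have hK : IsCompact K := ((isCompact_stdSimplex ℝ (Fin n)).image hφ).union
    ((isCompact_stdSimplex ℝ (Fin n)).image hφ.neg)
  have hC := (aux_compact_hull hK).isClosed
  have hmem : ∀ s ∈ auxT n, s⁻¹ • auxU n ∈ convexHull ℝ K := by
    intro s hs
    have h1 := aux_one_le n hs
    obtain ⟨N, a, x, hx, h, hs⟩ := hs
    have hs0 : 0 < s := by linarith
    let ν : Fin N → Fin n → ℝ := fun k =>
      if x k = 0 then Pi.single ⟨0, hn⟩ 1 else fun i => ‖x k‖⁻¹ * x k i
    have hν : ∀ k, ν k ∈ stdSimplex ℝ (Fin n) := by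
      intro k
      by_cases h0 : x k = 0
      · simp only [ν, h0, if_true]
        exact single_mem_stdSimplex ℝ _
      · simp only [ν, h0, if_false]
        refine ⟨fun i => mul_nonneg (by positivity) (hx k i), ?_⟩
        rw [← Finset.mul_sum, ← aux_norm (hx k)]
        exact inv_mul_cancel₀ (norm_ne_zero_iff.mpr h0)
    have hprod : ∀ k f, ∏ i, x k (f i) = ‖x k‖ ^ n * φ (ν k) f := by
      intro k f
      by_cases h0 : x k = 0
      · rw [h0, norm_zero, zero_pow (by omega), zero_mul]
        exact Finset.prod_eq_zero (Finset.mem_univ ⟨0, hn⟩) (by simp)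
      · simp only [φ, ν, h0, if_false]
        rw [Finset.prod_mul_distrib]
        simp only [Finset.prod_const, Finset.card_univ, Fintype.card_fin]
        rw [← mul_assoc, ← mul_pow, mul_inv_cancel₀ (norm_ne_zero_iff.mpr h0), one_pow, one_mul]
    refine mem_convexHull_of_exists_fintype (fun k => s⁻¹ * (|a k| * ‖x k‖ ^ n))
      (fun k => if 0 ≤ a k then φ (ν k) else - φ (ν k)) ?_ ?_ ?_ ?_
    · intro k; positivity
    · rw [← Finset.mul_sum, ← hs, inv_mul_cancel₀ hs0.ne']
    · intro k
      by_cases h0 : 0 ≤ a k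
      · simp only [h0, if_true]; exact Or.inl ⟨_, hν k, rfl⟩
      · simp only [h0, if_false]; exact Or.inr ⟨_, hν k, rfl⟩
    · funext f
      simp only [Finset.sum_apply, Pi.smul_apply, smul_eq_mul, h, Finset.mul_sum, hprod]
      refine Finset.sum_congr rfl fun k _ => ?_
      by_cases h0 : 0 ≤ a k
      · simp only [h0, if_true, abs_of_nonneg h0]; ring
      · simp only [h0, if_false, abs_of_neg (not_le.mp h0), Pi.neg_apply]; ring
  have hlim : (kappa n)⁻¹ • auxU n ∈ convexHull ℝ K := by
    obtain ⟨u, -, hu, hu'⟩ := exists_seq_tendsto_sInf (aux_nonempty n) (aux_bdd n)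
    rw [← aux_kappa] at hu
    exact hC.mem_of_tendsto ((hu.inv₀ (by linarith)).smul_const (auxU n))
      (Filter.Eventually.of_forall fun k => hmem _ (hu' k))
  obtain ⟨ι, hι, w, z, hw0, hw1, hz, hx⟩ := mem_convexHull_iff_exists_fintype.1 hlim
  have hz' : ∀ k, ∃ (ε : ℝ) (ν : Fin n → ℝ), |ε| = 1 ∧ ν ∈ stdSimplex ℝ (Fin n) ∧
      z k = ε • φ ν := by
    intro k
    rcases hz k with ⟨ν, hν, h⟩ | ⟨ν, hν, h⟩
    · exact ⟨1, ν, by simp, hν, by simp [← h]⟩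
    · exact ⟨-1, ν, by simp, hν, by simp [← h]⟩
  choose ε ν hε hν hzε using hz'
  refine ⟨ι, hι, fun k => kappa n * (w k * ε k), ν, hν, ?_, ?_⟩
  · intro f
    have := congrFun hx f
    simp only [Finset.sum_apply, Pi.smul_apply, smul_eq_mul, hzε] at this
    have h2 : auxU n f = kappa n * ((kappa n)⁻¹ * auxU n f) := by
      rw [← mul_assoc, mul_inv_cancel₀ (by linarith), one_mul]
    rw [h2, ← this, Finset.mul_sum]
    exact Finset.sum_congr rfl fun k _ => by simp only [φ]; ring
  · simp only [abs_mul, hε, mul_one]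
    rw [← Finset.mul_sum, abs_of_nonneg (by linarith : 0 ≤ kappa n)]
    simp only [abs_of_nonneg (hw0 _), hw1, mul_one, le_refl]

theorem aux_push (n : ℕ) {S : Type*} [DecidableEq S] (ν : Fin n → ℝ) (x y : Fin n → S) :
    ∏ i, (∑ j, if x j = y i then ν j else 0) =
      ∑ f : Fin n → Fin n, if x ∘ f = y then ∏ i, ν (f i) else 0 := by
  rw [Finset.prod_univ_sum, Fintype.piFinset_univ]
  refine Finset.sum_congr rfl fun f _ => ?_
  by_cases h : x ∘ f = y
  · rw [if_pos h]
    exact Finset.prod_congr rfl fun i _ => if_pos (congrFun h i)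
  · rw [if_neg h]
    obtain ⟨i, hi⟩ := Function.ne_iff.mp h
    exact Finset.prod_eq_zero (Finset.mem_univ i) (if_neg hi)


/-- Every exchangeable probability distribution `μ` on `Sⁿ` (for a finite `S`) is a signed
mixture `μ = Σₖ aₖ νₖ^⊗n` of `n`-th powers of probability distributions `νₖ` on `S` with
`Σₖ|aₖ| ≤ κ(n)`; moreover `κ(n)` is best possible: for `S = {1,…,n}` and `μ` the distribution
of a uniformly random permutation, every such representation has `Σₖ|aₖ| ≥ κ(n)`. -/
theorem exchangeable_signed_mixture (S : Type) [Fintype S] (n : ℕ) (hn : 1 ≤ n)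
    (μ : (Fin n → S) → ℝ) (hpos : ∀ x, 0 ≤ μ x) (hsum : ∑ x : Fin n → S, μ x = 1)
    (hexch : ∀ (σ : Equiv.Perm (Fin n)) (x : Fin n → S), μ (x ∘ σ) = μ x) :
    (∃ (N : ℕ) (a : Fin N → ℝ) (ν : Fin N → S → ℝ),
        (∀ k, (∀ s, 0 ≤ ν k s) ∧ ∑ s : S, ν k s = 1) ∧
        (∀ x : Fin n → S, μ x = ∑ k, a k * ∏ i, ν k (x i)) ∧
        ∑ k, |a k| ≤ kappa n) ∧
      ∀ (N : ℕ) (a : Fin N → ℝ) (ν : Fin N → Fin n → ℝ),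
        (∀ k, (∀ s, 0 ≤ ν k s) ∧ ∑ s : Fin n, ν k s = 1) →
        (∀ x : Fin n → Fin n,
          Set.indicator {y : Fin n → Fin n | Function.Bijective y}
              (fun _ => ((n.factorial : ℝ))⁻¹) x =
            ∑ k, a k * ∏ i, ν k (x i)) →
        kappa n ≤ ∑ k, |a k| := by
  classical
  constructor
  · obtain ⟨ι, hι, a, ν, hν, hrep, hle⟩ := aux_attain n hn
    let e := (Fintype.equivFin ((Fin n → S) × ι)).symm
    refine ⟨Fintype.card ((Fin n → S) × ι), fun k => μ (e k).1 * a (e k).2,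
      fun k s => ∑ j, if (e k).1 j = s then ν (e k).2 j else 0, ?_, ?_, ?_⟩
    · intro k
      refine ⟨fun s => Finset.sum_nonneg fun j _ => ?_, ?_⟩
      · split_ifs
        · exact (hν _).1 j
        · exact le_rfl
      · rw [Finset.sum_comm]
        simp only [Finset.sum_ite_eq, Finset.mem_univ, if_true]
        exact (hν _).2
    · intro y
      rw [e.sum_comp (fun q : (Fin n → S) × ι => μ q.1 * a q.2 *
        ∏ i, ∑ j, if q.1 j = y i then ν q.2 j else 0), Fintype.sum_prod_type]
      have h1 : ∀ x : Fin n → S, ∑ k, μ x * a k *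
          ∏ i, (∑ j, if x j = y i then ν k j else 0) =
          (n.factorial : ℝ)⁻¹ * ∑ σ : Equiv.Perm (Fin n), if x ∘ σ = y then μ x else 0 := by
        intro x
        have h2 := aux_sum_U n (fun f => if x ∘ f = y then μ x else 0)
        simp only [smul_eq_mul] at h2
        rw [← h2]
        simp only [aux_push, Finset.mul_sum]
        rw [Finset.sum_comm]
        refine Finset.sum_congr rfl fun f _ => ?_
        by_cases h : x ∘ f = y
        · simp only [h, if_true, hrep, Finset.sum_mul]
          exact Finset.sum_congr rfl fun k _ => by ring
        · simp [h]
      simp only [h1]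
      rw [← Finset.mul_sum, Finset.sum_comm]
      have h3 : ∀ σ : Equiv.Perm (Fin n), ∑ x : Fin n → S, (if x ∘ σ = y then μ x else 0) = μ y := by
        intro σ
        rw [Finset.sum_eq_single (y ∘ σ.symm)]
        · rw [if_pos, hexch]
          ext i; simp
        · intro x _ hx
          rw [if_neg]
          rintro rfl
          apply hx
          ext i; simp
        · simp
      simp only [h3, Finset.sum_const, Finset.card_univ, Fintype.card_perm, Fintype.card_fin,
        nsmul_eq_mul]
      rw [← mul_assoc, inv_mul_cancel₀ (by exact_mod_cast n.factorial_ne_zero), one_mul]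
    · rw [e.sum_comp (fun q : (Fin n → S) × ι => |μ q.1 * a q.2|), Fintype.sum_prod_type]
      simp only [abs_mul, abs_of_nonneg (hpos _)]
      rw [← Finset.sum_mul_sum, hsum, one_mul]
      exact hle
  · intro N a ν hν h
    rw [aux_kappa]
    refine csInf_le (aux_bdd n) ⟨N, a, fun k => WithLp.toLp 1 (ν k), fun k i => (hν k).1 i,
      fun f => h f, ?_⟩
    refine Finset.sum_congr rfl fun k _ => ?_
    rw [aux_norm (fun i => (hν k).1 i)]
    have : ∑ i, (WithLp.toLp 1 (ν k) : PiLp 1 fun _ : Fin n => ℝ) i = 1 := (hν k).2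
    rw [this, one_pow, mul_one]


end
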